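/- arXiv:2010.13491 — 2 statements merged into one kernel-verified Lean document; each statement's English description precedes it below -/
import Mathlib

section
/- Fix integers N and k with 2 ≤ k ≤ N − 1. Let d, d̂, β : Fin N → ℝ with d(1) ≤ d(2) ≤ … ≤ d(N) (true distances listed in nondecreasing order), β(j) > 0 for all j, and |d̂(j) − d(j)| ≤ β(j) for all j (the event E_β). Set U(j) = d̂(j) + β(j), L(j) = d̂(j) − β(j), μ₁ = (d(k−1) + d(k))/2 and μ₂ = (d(k) + d(k+1))/2. Let σ be a permutation of {1,…,N} with d̂(σ(1)) ≤ … ≤ d̂(σ(N)); set b = σ(k), let a₁ ∈ {σ(1),…,σ(k−1)} be an index maximizing U over that set, and let a₂ ∈ {σ(k+1),…,σ(N)} be an index minimizing L over that set. Say an index j is good if: d̂(j) + 3β(j) ≤ μ₁ in case j < k; both μ₁ ≤ d̂(j) − 3β(j) and d̂(j) + 3β(j) ≤ μ₂ in case j = k; and d̂(j) − 3β(j) ≥ μ₂ in case j > k. If a₁, a₂ and b are all good, then both stopping criteria of Find-k-NN hold: U(a₁) < L(b) and U(b) < L(a₂). -/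
/-- If a permutation of a finite type moves some point out of `p`, it moves some point into `p`. -/
theorem Equiv.Perm.exists_not_and_apply_of_not_apply {α : Type*} [Finite α] (σ : Equiv.Perm α)
    {p : α → Prop} {j : α} (hj : p j) (hσj : ¬ p (σ j)) : ∃ i, ¬ p i ∧ p (σ i) := by
  by_contra! h
  have hinv := Equiv.Perm.perm_symm_on_of_perm_on_finite (p := fun i => ¬ p i) h hσj
  rw [σ.symm_apply_apply] at hinv
  exact hinv hj

/-- The estimate `x` with radius `r` of the point of rank `i` (counted from `0`) clears the
thresholds `μ₁ ≤ μ₂` around the `k`-th smallest value by a margin of three radii. -/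
def WellSeparated (k : ℕ) (μ₁ μ₂ : ℝ) (i : ℕ) (x r : ℝ) : Prop :=
  (i + 1 < k → x + 3 * r ≤ μ₁) ∧
  (i + 1 = k → μ₁ ≤ x - 3 * r ∧ x + 3 * r ≤ μ₂) ∧
  (k ≤ i → μ₂ ≤ x - 3 * r)

/-- Let `x₁ ≤ x ≤ x₂` be well separated estimates of points of ranks `i₁`, `i`, `i₂`. If the upper
bound of `x₁` reaches `y` when `i` is too small to be the `k`-th rank, and the lower bound of `x₂`
stays below `y` when `i` is too large, then the three confidence intervals are disjoint. -/
theorem ucb_lt_lcb_of_wellSeparated {k i₁ i i₂ : ℕ} {μ₁ μ₂ y x₁ x x₂ r₁ r r₂ : ℝ}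
    (hr₁ : 0 < r₁) (hr : 0 < r) (hr₂ : 0 < r₂) (hμ₁ : μ₁ ≤ y) (hμ₂ : y ≤ μ₂)
    (hx₁ : x₁ ≤ x) (hx₂ : x ≤ x₂) (hi₁ : i₁ ≠ i) (hi₂ : i₂ ≠ i)
    (hU : i + 1 < k → y ≤ x₁ + r₁) (hL : k ≤ i → x₂ - r₂ ≤ y)
    (h₁ : WellSeparated k μ₁ μ₂ i₁ x₁ r₁) (h₂ : WellSeparated k μ₁ μ₂ i₂ x₂ r₂)
    (h : WellSeparated k μ₁ μ₂ i x r) :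
    x₁ + r₁ < x - r ∧ x + r < x₂ - r₂ := by
  obtain ⟨near₁, mid₁, far₁⟩ := h₁
  obtain ⟨near₂, mid₂, far₂⟩ := h₂
  obtain ⟨nearb, midb, farb⟩ := h
  rcases lt_trichotomy (i + 1) k with hb | hb | hb
  · exfalso
    have hb' := nearb hb
    have hU' := hU hb
    rcases lt_trichotomy (i₁ + 1) k with h | h | h
    · linarith [near₁ h]
    · linarith [(mid₁ h).1]
    · linarith [far₁ (by omega)]
  · obtain ⟨hbl, hbu⟩ := midb hb
    constructor
    · rcases lt_trichotomy (i₁ + 1) k with h | h | h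
      · linarith [near₁ h]
      · omega
      · linarith [far₁ (by omega)]
    · rcases lt_trichotomy (i₂ + 1) k with h | h | h
      · linarith [near₂ h]
      · omega
      · linarith [far₂ (by omega)]
  · exfalso
    have hb' := farb (by omega)
    have hL' := hL (by omega)
    rcases lt_trichotomy (i₂ + 1) k with h | h | h
    · linarith [near₂ h]
    · linarith [(mid₂ h).2]
    · linarith [far₂ (by omega)]

/-- Contrapositive form of Lemma 2 of the paper. Indices of `Fin N` are the true
ranks (0-indexed): `d j` is the distance of the `(j+1)`-th nearest neighbour, so
`d` is nondecreasing. `dh` are the empirical estimates, `β` the (positive)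
confidence radii, and `|dh j − d j| ≤ β j` is the event `E_β`. `σ` sorts the
estimates nondecreasingly, `b = σ(k)` (1-indexed, i.e. `σ ⟨k-1⟩`), `a₁` maximizes
the UCB `U = dh + β` over `{σ(1),…,σ(k−1)}`, and `a₂` minimizes the LCB
`L = dh − β` over `{σ(k+1),…,σ(N)}`. If `a₁`, `a₂`, `b` are all good (complement
of `E_bad` with `μ₁ = (d(k−1)+d(k))/2`, `μ₂ = (d(k)+d(k+1))/2`), then both
stopping criteria hold: `U(a₁) < L(b)` and `U(b) < L(a₂)`. -/
theorem stmt_7 (N k : ℕ) (hk1 : 2 ≤ k) (hk2 : k ≤ N - 1)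
    (d dh β : Fin N → ℝ)
    (hd : Monotone d)
    (hβ : ∀ j, 0 < β j)
    (hE : ∀ j, |dh j - d j| ≤ β j)
    (σ : Equiv.Perm (Fin N))
    (hσ : Monotone fun j => dh (σ j))
    (a₁ a₂ b : Fin N)
    (hb : b = σ ⟨k - 1, by omega⟩)
    (ha₁mem : ∃ j : Fin N, (j : ℕ) < k - 1 ∧ σ j = a₁)
    (ha₁max : ∀ j : Fin N, (j : ℕ) < k - 1 → dh (σ j) + β (σ j) ≤ dh a₁ + β a₁)
    (ha₂mem : ∃ j : Fin N, k ≤ (j : ℕ) ∧ σ j = a₂)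
    (ha₂min : ∀ j : Fin N, k ≤ (j : ℕ) → dh a₂ - β a₂ ≤ dh (σ j) - β (σ j))
    (good : Fin N → Prop)
    (hgood : ∀ j : Fin N, good j ↔
      (((j : ℕ) + 1 < k →
          dh j + 3 * β j ≤ (d ⟨k - 2, by omega⟩ + d ⟨k - 1, by omega⟩) / 2) ∧
       ((j : ℕ) + 1 = k →
          (d ⟨k - 2, by omega⟩ + d ⟨k - 1, by omega⟩) / 2 ≤ dh j - 3 * β j ∧
          dh j + 3 * β j ≤ (d ⟨k - 1, by omega⟩ + d ⟨k, by omega⟩) / 2) ∧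
       (k ≤ (j : ℕ) →
          (d ⟨k - 1, by omega⟩ + d ⟨k, by omega⟩) / 2 ≤ dh j - 3 * β j)))
    (hga₁ : good a₁) (hga₂ : good a₂) (hgb : good b) :
    dh a₁ + β a₁ < dh b - β b ∧ dh b + β b < dh a₂ - β a₂ := by
  have hd₁ : d ⟨k - 2, by omega⟩ ≤ d ⟨k - 1, by omega⟩ := hd (Fin.mk_le_mk.2 (by omega))
  have hd₂ : d ⟨k - 1, by omega⟩ ≤ d ⟨k, by omega⟩ := hd (Fin.mk_le_mk.2 (by omega))
  have h₁b : dh a₁ ≤ dh b ∧ (a₁ : ℕ) ≠ b := by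
    obtain ⟨j, hj, rfl⟩ := ha₁mem
    subst hb
    refine ⟨hσ (Fin.le_def.2 hj.le), fun h => hj.ne ?_⟩
    exact congrArg Fin.val (σ.injective (Fin.ext h))
  have hb₂ : dh b ≤ dh a₂ ∧ (a₂ : ℕ) ≠ b := by
    obtain ⟨j, hj, rfl⟩ := ha₂mem
    subst hb
    have hlt : k - 1 < (j : ℕ) := by omega
    refine ⟨hσ (Fin.le_def.2 hlt.le), fun h => hlt.ne' ?_⟩
    exact congrArg Fin.val (σ.injective (Fin.ext h))
  have hU : (b : ℕ) + 1 < k → d ⟨k - 1, by omega⟩ ≤ dh a₁ + β a₁ := fun h => by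
    obtain ⟨j, hj, hσj⟩ := σ.exists_not_and_apply_of_not_apply
      (p := fun i : Fin N => k - 1 ≤ (i : ℕ)) (j := ⟨k - 1, by omega⟩) le_rfl
      (by rw [← hb]; omega)
    have hdj : d ⟨k - 1, by omega⟩ ≤ d (σ j) := hd (Fin.le_def.2 hσj)
    linarith only [hdj, ha₁max j (not_le.1 hj), (abs_le.1 (hE (σ j))).1]
  have hL : k ≤ (b : ℕ) → dh a₂ - β a₂ ≤ d ⟨k - 1, by omega⟩ := fun h => by
    obtain ⟨j, hj, hσj⟩ := σ.exists_not_and_apply_of_not_apply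
      (p := fun i : Fin N => (i : ℕ) < k) (j := ⟨k - 1, by omega⟩)
      (Nat.sub_lt (by omega) one_pos) (by rw [← hb]; omega)
    have hdj : d (σ j) ≤ d ⟨k - 1, by omega⟩ := hd (Fin.le_def.2 (Nat.le_sub_one_of_lt hσj))
    linarith only [hdj, ha₂min j (not_lt.1 hj), (abs_le.1 (hE (σ j))).2]
  exact ucb_lt_lcb_of_wellSeparated (hβ _) (hβ _) (hβ _) (by linarith only [hd₁])
    (by linarith only [hd₂]) h₁b.1 hb₂.1 h₁b.2 hb₂.2 hU hL
    ((hgood _).1 hga₁) ((hgood _).1 hga₂) ((hgood _).1 hgb)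
end

section
/- Fix integers N and k with 2 ≤ k ≤ N − 1. Let d, d̂, β : Fin N → ℝ with β(j) ≥ 0 and |d̂(j) − d(j)| ≤ β(j) for all j (the event E_β). Set U(j) = d̂(j) + β(j) and L(j) = d̂(j) − β(j). Let σ be a permutation of {1,…,N} with d̂(σ(1)) ≤ … ≤ d̂(σ(N)); set b = σ(k), let a₁ ∈ {σ(1),…,σ(k−1)} be an index maximizing U over that set, and let a₂ ∈ {σ(k+1),…,σ(N)} be an index minimizing L over that set. If the two stopping criteria U(a₁) < L(b) and U(b) < L(a₂) hold, then d(j) < d(b) for every j ∈ {σ(1),…,σ(k−1)} and d(b) < d(j) for every j ∈ {σ(k+1),…,σ(N)}; consequently d(b) is the k-th smallest value of d, i.e., the point b returned by Find-k-NN is the true k-th nearest neighbour. -/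
/-- The `k`-th smallest value (1-indexed) of `f : Fin N → ℝ`:
the `k`-th entry of the nondecreasing rearrangement of `f 0, …, f (N-1)`. -/
noncomputable def kthSmallest {N : ℕ} (f : Fin N → ℝ) (k : ℕ) : ℝ :=
  (List.insertionSort (· ≤ ·) (List.ofFn f)).getD (k - 1) 0

theorem List.insertionSort_eq_append_cons_of_perm {α : Type*} [LinearOrder α]
    {l A B : List α} {x : α} (h : l.Perm (A ++ x :: B))
    (hA : ∀ y ∈ A, y ≤ x) (hB : ∀ y ∈ B, x ≤ y) :
    l.insertionSort (· ≤ ·) =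
      A.insertionSort (· ≤ ·) ++ x :: B.insertionSort (· ≤ ·) := by
  have hperm : (l.insertionSort (· ≤ ·)).Perm
      (A.insertionSort (· ≤ ·) ++ x :: B.insertionSort (· ≤ ·)) :=
    (List.perm_insertionSort _ l).trans <| h.trans <|
      ((List.perm_insertionSort _ A).append ((List.perm_insertionSort _ B).cons x)).symm
  refine hperm.eq_of_pairwise (le := (· ≤ ·)) (fun a b _ _ => le_antisymm)
    (List.pairwise_insertionSort _ l) ?_
  refine List.pairwise_append.2 ⟨List.pairwise_insertionSort _ A,
    List.pairwise_cons.2 ⟨?_, List.pairwise_insertionSort _ B⟩, ?_⟩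
  · intro y hy
    exact hB y ((List.mem_insertionSort _).1 hy)
  · intro a ha c hc
    have hax := hA a ((List.mem_insertionSort _).1 ha)
    rcases List.mem_cons.1 hc with rfl | hc
    · exact hax
    · exact hax.trans (hB c ((List.mem_insertionSort _).1 hc))

theorem kthSmallest_succ_eq_of_perm {N : ℕ} (f : Fin N → ℝ) (σ : Equiv.Perm (Fin N))
    (i : Fin N) (hlt : ∀ j < i, f (σ j) ≤ f (σ i)) (hgt : ∀ j, i < j → f (σ i) ≤ f (σ j)) :
    kthSmallest f (i + 1) = f (σ i) := by
  set g := List.ofFn (f ∘ σ) with hg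
  have hlen : (i : ℕ) < g.length := by simp [hg]
  have hperm : (List.ofFn f).Perm (g.take i ++ f (σ i) :: g.drop (i + 1)) := by
    have hx : f (σ i) = g[(i : ℕ)] := by simp [hg]
    rw [hx, List.getElem_cons_drop, List.take_append_drop]
    exact (σ.ofFn_comp_perm f).symm
  have hsort := List.insertionSort_eq_append_cons_of_perm hperm
    (fun y hy => by
      obtain ⟨j, hj, rfl⟩ := List.mem_take_iff_getElem.1 hy
      have hji : j < (i : ℕ) := by omega
      simpa [hg] using hlt ⟨j, hji.trans i.2⟩ hji)
    (fun y hy => by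
      obtain ⟨j, hj, rfl⟩ := List.mem_drop_iff_getElem.1 hy
      have hjN : (i : ℕ) + 1 + j < N := by simpa [hg, add_comm, add_left_comm, add_assoc] using hj
      simpa [hg] using hgt ⟨i + 1 + j, hjN⟩ (Fin.lt_def.2 (by simp; omega)))
  have hl : ((g.take i).insertionSort (· ≤ ·)).length = i := by
    rw [List.length_insertionSort, List.length_take, min_eq_left hlen.le]
  rw [kthSmallest, hsort, Nat.add_sub_cancel, List.getD_append_right _ _ _ _ hl.le, hl]
  simp

/-- Correctness of Find-k-NN: `d j` is the true distance of the `j`-th neighbour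
(indices not assumed sorted), `dh j` the empirical estimate with confidence
radius `β j ≥ 0`, and `|dh j − d j| ≤ β j` is the event `E_β`. With
`U = dh + β`, `L = dh − β`, `σ` sorting the estimates nondecreasingly,
`b = σ(k)` (1-indexed), `a₁` maximizing `U` over `{σ(1),…,σ(k−1)}` and `a₂`
minimizing `L` over `{σ(k+1),…,σ(N)}`, if the stopping criteria
`U(a₁) < L(b)` and `U(b) < L(a₂)` hold, then `d j < d b` for every
`j ∈ {σ(1),…,σ(k−1)}`, `d b < d j` for every `j ∈ {σ(k+1),…,σ(N)}`, and
consequently `d b` is the `k`-th smallest value of `d`. -/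
theorem stmt_8 (N k : ℕ) (hk1 : 2 ≤ k) (hk2 : k ≤ N - 1)
    (d dh β : Fin N → ℝ)
    (hβ : ∀ j, 0 ≤ β j)
    (hE : ∀ j, |dh j - d j| ≤ β j)
    (σ : Equiv.Perm (Fin N))
    (hσ : Monotone fun j => dh (σ j))
    (a₁ a₂ b : Fin N)
    (hb : b = σ ⟨k - 1, by omega⟩)
    (ha₁mem : ∃ j : Fin N, (j : ℕ) < k - 1 ∧ σ j = a₁)
    (ha₁max : ∀ j : Fin N, (j : ℕ) < k - 1 → dh (σ j) + β (σ j) ≤ dh a₁ + β a₁)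
    (ha₂mem : ∃ j : Fin N, k ≤ (j : ℕ) ∧ σ j = a₂)
    (ha₂min : ∀ j : Fin N, k ≤ (j : ℕ) → dh a₂ - β a₂ ≤ dh (σ j) - β (σ j))
    (hstop1 : dh a₁ + β a₁ < dh b - β b)
    (hstop2 : dh b + β b < dh a₂ - β a₂) :
    (∀ j : Fin N, (j : ℕ) < k - 1 → d (σ j) < d b) ∧
    (∀ j : Fin N, k ≤ (j : ℕ) → d b < d (σ j)) ∧
    d b = kthSmallest d k := by
  have hlt : ∀ j : Fin N, (j : ℕ) < k - 1 → d (σ j) < d b := fun j hj => by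
    linarith [ha₁max j hj, (abs_le.1 (hE (σ j))).1, (abs_le.1 (hE (σ j))).2,
      (abs_le.1 (hE b)).1, (abs_le.1 (hE b)).2]
  have hgt : ∀ j : Fin N, k ≤ (j : ℕ) → d b < d (σ j) := fun j hj => by
    linarith [ha₂min j hj, (abs_le.1 (hE (σ j))).1, (abs_le.1 (hE (σ j))).2,
      (abs_le.1 (hE b)).1, (abs_le.1 (hE b)).2]
  refine ⟨hlt, hgt, ?_⟩
  subst hb
  have h := kthSmallest_succ_eq_of_perm d σ ⟨k - 1, by omega⟩
    (fun j hj => (hlt j hj).le)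
    (fun j hj => (hgt j (by have := Fin.lt_def.1 hj; simp only at this; omega)).le)
  rw [← h, Nat.sub_add_cancel (by omega : 1 ≤ k)]
end
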